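/- arXiv:2604.09699 — 2 statements merged into one kernel-verified Lean document; each statement's English description precedes it below -/
import Mathlib

section
/- The graph of the fixed point f = (f_1, f_2) of T is invariant under the system: Gr(f) = ⋃_{i=1}^n ω_i(Gr(f)), where Gr(f) = {(x, f_1(x), f_2(x)) : x ∈ I}. -/
open Set

namespace ZHV

noncomputable section

variable {n : ℕ}

/-- Index `i-1+ε_i` (image of `x₀` under `L_i`). -/
def e0 (ε : Fin n → Bool) (i : Fin n) : Fin (n + 1) :=
  if ε i then i.succ else i.castSucc

/-- Index `i-ε_i` (image of `x_n` under `L_i`). -/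
def e1 (ε : Fin n → Bool) (i : Fin n) : Fin (n + 1) :=
  if ε i then i.castSucc else i.succ

/-- The interval `I = [x₀, x_n]`. -/
def Ifull (X : Fin (n + 1) → ℝ) : Set ℝ := Icc (X 0) (X (Fin.last n))

/-- The subinterval `I_i = [x_{i-1}, x_i]`. -/
def Isub (X : Fin (n + 1) → ℝ) (i : Fin n) : Set ℝ := Icc (X i.castSucc) (X i.succ)

def acoef (X : Fin (n + 1) → ℝ) (ε : Fin n → Bool) (i : Fin n) : ℝ :=
  (X (e1 ε i) - X (e0 ε i)) / (X (Fin.last n) - X 0)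

def bcoef (X : Fin (n + 1) → ℝ) (ε : Fin n → Bool) (i : Fin n) : ℝ :=
  (X (e0 ε i) * X (Fin.last n) - X (e1 ε i) * X 0) / (X (Fin.last n) - X 0)

/-- `L_i(t) = a_i t + b_i`. -/
def Lmap (X : Fin (n + 1) → ℝ) (ε : Fin n → Bool) (i : Fin n) (t : ℝ) : ℝ :=
  acoef X ε i * t + bcoef X ε i

/-- `L_i⁻¹`. -/
def Linv (X : Fin (n + 1) → ℝ) (ε : Fin n → Bool) (i : Fin n) (t : ℝ) : ℝ :=
  (t - bcoef X ε i) / acoef X ε i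

/-- `μ(t) = (t - x₀)/(x_n - x₀)`. -/
def mu (X : Fin (n + 1) → ℝ) (t : ℝ) : ℝ := (t - X 0) / (X (Fin.last n) - X 0)

/-- The affine function through `(x₀, w₀)` and `(x_n, w_n)`:
`μ(t)·w_n + (1-μ(t))·w₀`. -/
def base (X W : Fin (n + 1) → ℝ) (t : ℝ) : ℝ :=
  mu X t * W (Fin.last n) + (1 - mu X t) * W 0

/-- `F_{i,1}`. -/
def F1 (X Y Z : Fin (n + 1) → ℝ) (ε : Fin n → Bool) (p q : Fin n → ℝ → ℝ)
    (i : Fin n) (t yv zv : ℝ) : ℝ :=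
  p i (Lmap X ε i t) * (yv - base X Y t) + q i (Lmap X ε i t) * (zv - base X Z t)
    + (mu X t * Y (e1 ε i) + (1 - mu X t) * Y (e0 ε i))

/-- `F_{i,2}`. -/
def F2 (X Y Z : Fin (n + 1) → ℝ) (ε : Fin n → Bool) (pt qt : Fin n → ℝ → ℝ)
    (i : Fin n) (t yv zv : ℝ) : ℝ :=
  pt i (Lmap X ε i t) * (yv - base X Y t) + qt i (Lmap X ε i t) * (zv - base X Z t)
    + (mu X t * Z (e1 ε i) + (1 - mu X t) * Z (e0 ε i))

/-- `ω_i(x,y,z) = (L_i(x), F_{i,1}(x,y,z), F_{i,2}(x,y,z))`. -/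
def wmap (X Y Z : Fin (n + 1) → ℝ) (ε : Fin n → Bool) (p q pt qt : Fin n → ℝ → ℝ)
    (i : Fin n) (P : ℝ × ℝ × ℝ) : ℝ × ℝ × ℝ :=
  (Lmap X ε i P.1, F1 X Y Z ε p q i P.1 P.2.1 P.2.2, F2 X Y Z ε pt qt i P.1 P.2.1 P.2.2)

/-- `r_i`. -/
def rmap (X Y Z : Fin (n + 1) → ℝ) (ε : Fin n → Bool) (p q : Fin n → ℝ → ℝ)
    (i : Fin n) (t : ℝ) : ℝ :=
  (mu X t * Y (e1 ε i) + (1 - mu X t) * Y (e0 ε i))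
    - p i (Lmap X ε i t) * base X Y t - q i (Lmap X ε i t) * base X Z t

/-- `r̃_i`. -/
def rtmap (X Y Z : Fin (n + 1) → ℝ) (ε : Fin n → Bool) (pt qt : Fin n → ℝ → ℝ)
    (i : Fin n) (t : ℝ) : ℝ :=
  (mu X t * Z (e1 ε i) + (1 - mu X t) * Z (e0 ε i))
    - pt i (Lmap X ε i t) * base X Y t - qt i (Lmap X ε i t) * base X Z t

/-- Sup norm of `g` on the subinterval `I_i`. -/
def snormSub (X : Fin (n + 1) → ℝ) (i : Fin n) (g : ℝ → ℝ) : ℝ :=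
  sSup ((fun t => |g t|) '' Isub X i)

/-- Sup norm of `g` on `I`. -/
def snormFull (X : Fin (n + 1) → ℝ) (g : ℝ → ℝ) : ℝ :=
  sSup ((fun t => |g t|) '' Ifull X)

/-- The constant `U`. -/
def Uval (X Y Z : Fin (n + 1) → ℝ) (ε : Fin n → Bool) (p q pt qt : Fin n → ℝ → ℝ) : ℝ :=
  ⨆ i : Fin n,
    (snormSub X i (q i) * snormFull X (rtmap X Y Z ε pt qt i)
        + (1 - snormSub X i (qt i)) * snormFull X (rmap X Y Z ε p q i)) /
      ((1 - snormSub X i (p i)) * (1 - snormSub X i (qt i))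
        - snormSub X i (pt i) * snormSub X i (q i))

/-- The constant `Ũ`. -/
def Utval (X Y Z : Fin (n + 1) → ℝ) (ε : Fin n → Bool) (p q pt qt : Fin n → ℝ → ℝ) : ℝ :=
  ⨆ i : Fin n,
    (snormSub X i (pt i) * snormFull X (rmap X Y Z ε p q i)
        + (1 - snormSub X i (p i)) * snormFull X (rtmap X Y Z ε pt qt i)) /
      ((1 - snormSub X i (p i)) * (1 - snormSub X i (qt i))
        - snormSub X i (pt i) * snormSub X i (q i))

/-- The set `E = [-U,U] × [-Ũ,Ũ]`. -/
def Eset (X Y Z : Fin (n + 1) → ℝ) (ε : Fin n → Bool) (p q pt qt : Fin n → ℝ → ℝ) :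
    Set (ℝ × ℝ) :=
  Icc (-(Uval X Y Z ε p q pt qt)) (Uval X Y Z ε p q pt qt) ×ˢ
    Icc (-(Utval X Y Z ε p q pt qt)) (Utval X Y Z ε p q pt qt)

/-- `S̄ = max_i max{‖p_i‖+‖p̃_i‖, ‖q_i‖+‖q̃_i‖}`. -/
def Sbar (X : Fin (n + 1) → ℝ) (p q pt qt : Fin n → ℝ → ℝ) : ℝ :=
  ⨆ i : Fin n,
    max (snormSub X i (p i) + snormSub X i (pt i))
      (snormSub X i (q i) + snormSub X i (qt i))

/-- Minimum value of `g` on `I_i`. -/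
def fmin (X : Fin (n + 1) → ℝ) (i : Fin n) (g : ℝ → ℝ) : ℝ := sInf (g '' Isub X i)

/-- Maximum value of `g` on `I_i`. -/
def fmax (X : Fin (n + 1) → ℝ) (i : Fin n) (g : ℝ → ℝ) : ℝ := sSup (g '' Isub X i)

/-- The constant `M` of Section 4. -/
def Mval (X Y Z : Fin (n + 1) → ℝ) (p q pt qt : Fin n → ℝ → ℝ) : ℝ :=
  ((⨆ j, Y j) + (⨆ j, Z j)
      - (⨆ i : Fin n, (max (snormSub X i (p i)) (snormSub X i (q i))
          + max (snormSub X i (pt i)) (snormSub X i (qt i))))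
        * (min (Y 0) (Y (Fin.last n)) + min (Z 0) (Z (Fin.last n)))) /
    (1 - ⨆ i : Fin n, (max (snormSub X i (p i)) (snormSub X i (q i))
        + max (snormSub X i (pt i)) (snormSub X i (qt i))))

/-- The slope `m_i = (y_i - y_{i-1})/(x_i - x_{i-1})`. -/
def mslope (X Y : Fin (n + 1) → ℝ) (i : Fin n) : ℝ :=
  (Y i.succ - Y i.castSucc) / (X i.succ - X i.castSucc)

/-- The standing hypotheses: the `x_i` are strictly increasing, the vertical scaling
factors are Lipschitz on `I_i` and satisfy `‖p_i‖+‖p̃_i‖ < 1` and `‖q_i‖+‖q̃_i‖ < 1`. -/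
def Hyps (X : Fin (n + 1) → ℝ) (p q pt qt : Fin n → ℝ → ℝ) : Prop :=
  StrictMono X ∧
  (∀ i, ∃ K : NNReal, LipschitzOnWith K (p i) (Isub X i)) ∧
  (∀ i, ∃ K : NNReal, LipschitzOnWith K (pt i) (Isub X i)) ∧
  (∀ i, ∃ K : NNReal, LipschitzOnWith K (q i) (Isub X i)) ∧
  (∀ i, ∃ K : NNReal, LipschitzOnWith K (qt i) (Isub X i)) ∧
  (∀ i, snormSub X i (p i) + snormSub X i (pt i) < 1) ∧
  (∀ i, snormSub X i (q i) + snormSub X i (qt i) < 1)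

/-- `(f₁,f₂)` is a fixed point of the Read operator `T` on `C₀²(I)`:
it belongs to `C₀²(I)` and satisfies `f(x) = F_i(L_i⁻¹(x), f(L_i⁻¹(x)))` on each `I_i`. -/
def IsFixedPt (X Y Z : Fin (n + 1) → ℝ) (ε : Fin n → Bool)
    (p q pt qt : Fin n → ℝ → ℝ) (f1 f2 : ℝ → ℝ) : Prop :=
  ContinuousOn f1 (Ifull X) ∧ ContinuousOn f2 (Ifull X) ∧
  f1 (X 0) = Y 0 ∧ f2 (X 0) = Z 0 ∧
  f1 (X (Fin.last n)) = Y (Fin.last n) ∧ f2 (X (Fin.last n)) = Z (Fin.last n) ∧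
  ∀ i : Fin n, ∀ t ∈ Isub X i,
    f1 t = F1 X Y Z ε p q i (Linv X ε i t) (f1 (Linv X ε i t)) (f2 (Linv X ε i t)) ∧
    f2 t = F2 X Y Z ε pt qt i (Linv X ε i t) (f1 (Linv X ε i t)) (f2 (Linv X ε i t))

/-- The graph `{(x, f₁(x), f₂(x)) : x ∈ I}`. -/
def Graph (X : Fin (n + 1) → ℝ) (f1 f2 : ℝ → ℝ) : Set (ℝ × ℝ × ℝ) :=
  (fun t => (t, f1 t, f2 t)) '' Ifull X

/-- The metric `ρ_θ`. -/
def rho (θ : ℝ) (P Q : ℝ × ℝ × ℝ) : ℝ :=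
  |P.1 - Q.1| + θ * (|P.2.1 - Q.2.1| + |P.2.2 - Q.2.2|)

/-- The Euclidean distance on `ℝ³`. -/
def euclDist (P Q : ℝ × ℝ × ℝ) : ℝ :=
  Real.sqrt ((P.1 - Q.1) ^ 2 + (P.2.1 - Q.2.1) ^ 2 + (P.2.2 - Q.2.2) ^ 2)

end

end ZHV

open ZHV Set

namespace ZHV

variable {n : ℕ} {X : Fin (n + 1) → ℝ}

theorem first_lt_last (hX : StrictMono X) (i : Fin n) : X 0 < X (Fin.last n) :=
  hX (lt_of_le_of_lt (Fin.zero_le i.castSucc) (Fin.castSucc_lt_last i))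

theorem Lmap_eq (hX : StrictMono X) (ε : Fin n → Bool) (i : Fin n) (t : ℝ) :
    Lmap X ε i t = X (e0 ε i) + mu X t * (X (e1 ε i) - X (e0 ε i)) := by
  have hD : X (Fin.last n) - X 0 ≠ 0 :=
    (sub_pos.2 (first_lt_last hX i)).ne'
  unfold Lmap acoef bcoef mu
  field_simp
  ring

theorem acoef_ne_zero (hX : StrictMono X) (ε : Fin n → Bool) (i : Fin n) :
    acoef X ε i ≠ 0 := by
  have hD : X (Fin.last n) - X 0 ≠ 0 :=
    (sub_pos.2 (first_lt_last hX i)).ne'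
  refine div_ne_zero (sub_ne_zero.2 fun h => ?_) hD
  have hi : X i.castSucc < X i.succ := hX Fin.castSucc_lt_succ
  unfold e0 e1 at h
  cases hε : ε i <;> simp [hε] at h <;> linarith

theorem Linv_Lmap (hX : StrictMono X) (ε : Fin n → Bool) (i : Fin n) (t : ℝ) :
    Linv X ε i (Lmap X ε i t) = t := by
  have := acoef_ne_zero hX ε i
  unfold Linv Lmap
  field_simp
  ring

theorem Lmap_Linv (hX : StrictMono X) (ε : Fin n → Bool) (i : Fin n) (t : ℝ) :
    Lmap X ε i (Linv X ε i t) = t := by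
  have := acoef_ne_zero hX ε i
  unfold Linv Lmap
  field_simp
  ring

theorem mem_Ifull_iff_mu (h : X 0 < X (Fin.last n)) (t : ℝ) :
    t ∈ Ifull X ↔ 0 ≤ mu X t ∧ mu X t ≤ 1 := by
  have hD := sub_pos.2 h
  unfold Ifull mu
  rw [le_div_iff₀ hD, div_le_one hD, mem_Icc]
  constructor <;> rintro ⟨h₁, h₂⟩ <;> constructor <;> linarith

theorem Lmap_mem_Isub_iff (hX : StrictMono X) (ε : Fin n → Bool) (i : Fin n) (t : ℝ) :
    Lmap X ε i t ∈ Isub X i ↔ t ∈ Ifull X := by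
  have hi : 0 < X i.succ - X i.castSucc := sub_pos.2 (hX Fin.castSucc_lt_succ)
  rw [mem_Ifull_iff_mu (first_lt_last hX i), Lmap_eq hX, Isub, mem_Icc]
  unfold e0 e1
  cases hε : ε i <;> simp only [if_true, if_false, Bool.false_eq_true] <;>
    constructor <;> rintro ⟨h₁, h₂⟩ <;> constructor <;> nlinarith

theorem Isub_subset_Ifull (hX : StrictMono X) (i : Fin n) : Isub X i ⊆ Ifull X :=
  Icc_subset_Icc (hX.monotone (Fin.zero_le _)) (hX.monotone (Fin.le_last _))

theorem exists_mem_Isub (hn : 0 < n) {t : ℝ} (ht : t ∈ Ifull X) : ∃ i, t ∈ Isub X i := by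
  by_contra! h
  have key : ∀ j : Fin (n + 1), j ≠ 0 → X j < t := by
    intro j
    induction j using Fin.induction with
    | zero => exact fun h₀ => absurd rfl h₀
    | succ i ih =>
      intro _
      by_contra! hi
      refine h i ⟨?_, hi⟩
      by_cases h₀ : i.castSucc = 0
      · rw [h₀]; exact ht.1
      · exact (ih h₀).le
  exact absurd ht.2 (not_le.2 (key (Fin.last n) (Fin.ne_of_gt hn)))

end ZHV

/-- The graph of the fixed point of `T` is invariant under the ZHVIFS. -/
theorem statement8 {n : ℕ} (hn : 0 < n) (X Y Z : Fin (n + 1) → ℝ) (ε : Fin n → Bool)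
    (p q pt qt : Fin n → ℝ → ℝ) (hyp : Hyps X p q pt qt)
    (f1 f2 : ℝ → ℝ) (hf : IsFixedPt X Y Z ε p q pt qt f1 f2) :
    Graph X f1 f2 = ⋃ i : Fin n, wmap X Y Z ε p q pt qt i '' Graph X f1 f2 := by
  have hX := hyp.1
  obtain ⟨-, -, -, -, -, -, hfix⟩ := hf
  ext P
  simp only [mem_iUnion]
  constructor
  · rintro ⟨t, ht, rfl⟩
    obtain ⟨i, hi⟩ := exists_mem_Isub hn ht
    have hs : Linv X ε i t ∈ Ifull X := by
      rwa [← Lmap_mem_Isub_iff hX ε i, Lmap_Linv hX]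
    refine ⟨i, _, ⟨_, hs, rfl⟩, ?_⟩
    obtain ⟨h₁, h₂⟩ := hfix i t hi
    exact Prod.ext (Lmap_Linv hX ε i t) (Prod.ext h₁.symm h₂.symm)
  · rintro ⟨i, -, ⟨t, ht, rfl⟩, rfl⟩
    have hs : Lmap X ε i t ∈ Isub X i := (Lmap_mem_Isub_iff hX ε i t).2 ht
    refine ⟨_, Isub_subset_Ifull hX i hs, ?_⟩
    obtain ⟨h₁, h₂⟩ := hfix i _ hs
    rw [Linv_Lmap hX] at h₁ h₂
    exact Prod.ext rfl (Prod.ext h₁ h₂)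
end

section
/- Assume y_i ≥ 0 and z_i ≥ 0 for all i = 0,…,n. Fix i ∈ {1,…,n} and suppose p_i(x) ≥ 0 and q_i(x) ≥ 0 for all x ∈ I_i. If p_i^max ≤ min{y_{i-1},y_i}/max{y_0,y_n} and q_i^max ≤ [min{y_{i-1},y_i} - p_i^max·max{y_0,y_n}]/max{z_0,z_n}, then F_{i,1}(x,y,z) ≥ 0 for every x ∈ I and all y ≥ 0, z ≥ 0. -/
open Set

open ZHV Set

namespace ZHV

section Bounds

variable {n : ℕ} {X : Fin (n + 1) → ℝ}

lemma mu_mem_Icc (h : X 0 < X (Fin.last n)) {t : ℝ} (ht : t ∈ Ifull X) :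
    mu X t ∈ Icc (0 : ℝ) 1 := by
  have h' : 0 < X (Fin.last n) - X 0 := sub_pos.2 h
  exact ⟨div_nonneg (sub_nonneg.2 ht.1) h'.le,
    (div_le_one h').2 (sub_le_sub_right ht.2 _)⟩

lemma Lmap_eq_convex_comb (h : X 0 < X (Fin.last n)) (ε : Fin n → Bool) (i : Fin n) (t : ℝ) :
    Lmap X ε i t = mu X t * X (e1 ε i) + (1 - mu X t) * X (e0 ε i) := by
  have h' : X (Fin.last n) - X 0 ≠ 0 := (sub_pos.2 h).ne'
  unfold Lmap acoef bcoef mu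
  field_simp
  ring

/-- A convex combination of the two endpoint values lies between their minimum and maximum. -/
lemma convex_comb_mem_Icc {m a b : ℝ} (hm : m ∈ Icc (0 : ℝ) 1) :
    m * a + (1 - m) * b ∈ Icc (min a b) (max a b) := by
  have h : 0 ≤ 1 - m := sub_nonneg.2 hm.2
  constructor
  · nlinarith [mul_le_mul_of_nonneg_left (min_le_left a b) hm.1,
      mul_le_mul_of_nonneg_left (min_le_right a b) h]
  · nlinarith [mul_le_mul_of_nonneg_left (le_max_left a b) hm.1,
      mul_le_mul_of_nonneg_left (le_max_right a b) h]

lemma min_e1_e0 (W : Fin (n + 1) → ℝ) (ε : Fin n → Bool) (i : Fin n) :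
    min (W (e1 ε i)) (W (e0 ε i)) = min (W i.castSucc) (W i.succ) := by
  unfold e0 e1
  split_ifs
  · rfl
  · exact min_comm _ _

lemma max_e1_e0 (W : Fin (n + 1) → ℝ) (ε : Fin n → Bool) (i : Fin n) :
    max (W (e1 ε i)) (W (e0 ε i)) = max (W i.castSucc) (W i.succ) := by
  unfold e0 e1
  split_ifs
  · rfl
  · exact max_comm _ _

lemma Lmap_mem_Isub (hX : StrictMono X) (h : X 0 < X (Fin.last n)) (ε : Fin n → Bool)
    (i : Fin n) {t : ℝ} (ht : t ∈ Ifull X) : Lmap X ε i t ∈ Isub X i := by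
  have hle : X i.castSucc ≤ X i.succ := (hX i.castSucc_lt_succ).le
  have hmem := convex_comb_mem_Icc (a := X (e1 ε i)) (b := X (e0 ε i)) (mu_mem_Icc h ht)
  rwa [min_e1_e0, max_e1_e0, min_eq_left hle, max_eq_right hle,
    ← Lmap_eq_convex_comb h] at hmem

lemma base_le_max (h : X 0 < X (Fin.last n)) (W : Fin (n + 1) → ℝ) {t : ℝ}
    (ht : t ∈ Ifull X) : base X W t ≤ max (W 0) (W (Fin.last n)) :=
  (convex_comb_mem_Icc (mu_mem_Icc h ht)).2.trans_eq (max_comm _ _)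

lemma le_fmax {i : Fin n} {g : ℝ → ℝ} (hg : ContinuousOn g (Isub X i)) {s : ℝ}
    (hs : s ∈ Isub X i) : g s ≤ fmax X i g :=
  le_csSup (isCompact_Icc.image_of_continuousOn hg).bddAbove (mem_image_of_mem g hs)

end Bounds

end ZHV

/-- Case 1 of Theorem 4. If `p_i, q_i ≥ 0` on `I_i` and
`p_i^max ≤ min{y_{i-1},y_i}/max{y₀,y_n}`,
`q_i^max ≤ (min{y_{i-1},y_i} - p_i^max·max{y₀,y_n})/max{z₀,z_n}`,
then `F_{i,1}(x,y,z) ≥ 0` for `x ∈ I`, `y ≥ 0`, `z ≥ 0`. -/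
theorem statement14 {n : ℕ} (hn : 0 < n) (X Y Z : Fin (n + 1) → ℝ) (ε : Fin n → Bool)
    (p q pt qt : Fin n → ℝ → ℝ) (hyp : Hyps X p q pt qt)
    (hY : ∀ j, 0 ≤ Y j) (hZ : ∀ j, 0 ≤ Z j)
    (i : Fin n)
    (hsign : ∀ t ∈ Isub X i, 0 ≤ p i t ∧ 0 ≤ q i t)
    (hp : fmax X i (p i) ≤
      min (Y i.castSucc) (Y i.succ) / max (Y 0) (Y (Fin.last n)))
    (hq : fmax X i (q i) ≤
      (min (Y i.castSucc) (Y i.succ)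
          - fmax X i (p i) * max (Y 0) (Y (Fin.last n))) /
        max (Z 0) (Z (Fin.last n))) :
    ∀ t ∈ Ifull X, ∀ yv zv : ℝ, 0 ≤ yv → 0 ≤ zv →
      0 ≤ F1 X Y Z ε p q i t yv zv := by
  intro t ht yv zv hyv hzv
  obtain ⟨hX, hpL, -, hqL, -⟩ := hyp
  obtain ⟨_, hpL⟩ := hpL i
  obtain ⟨_, hqL⟩ := hqL i
  have h0n : X 0 < X (Fin.last n) := hX (Fin.lt_def.2 hn)
  have hs := Lmap_mem_Isub hX h0n ε i ht
  obtain ⟨hp0, hq0⟩ := hsign _ hs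
  have hYmax : 0 ≤ max (Y 0) (Y (Fin.last n)) := le_max_of_le_left (hY 0)
  have hZmax : 0 ≤ max (Z 0) (Z (Fin.last n)) := le_max_of_le_left (hZ 0)
  have hpY := mul_le_of_le_div₀ (le_min (hY _) (hY _)) hYmax hp
  have hqZ := mul_le_of_le_div₀ (sub_nonneg.2 hpY) hZmax hq
  have hpbase : p i (Lmap X ε i t) * base X Y t ≤
      fmax X i (p i) * max (Y 0) (Y (Fin.last n)) :=
    (mul_le_mul_of_nonneg_left (base_le_max h0n Y ht) hp0).trans
      (mul_le_mul_of_nonneg_right (le_fmax hpL.continuousOn hs) hYmax)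
  have hqbase : q i (Lmap X ε i t) * base X Z t ≤
      fmax X i (q i) * max (Z 0) (Z (Fin.last n)) :=
    (mul_le_mul_of_nonneg_left (base_le_max h0n Z ht) hq0).trans
      (mul_le_mul_of_nonneg_right (le_fmax hqL.continuousOn hs) hZmax)
  have hmin := (convex_comb_mem_Icc (a := Y (e1 ε i)) (b := Y (e0 ε i))
    (mu_mem_Icc h0n ht)).1
  rw [min_e1_e0] at hmin
  unfold F1
  linarith [mul_nonneg hp0 hyv, mul_nonneg hq0 hzv]
end
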